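/- For the complex C of the torus knot T_{3,4} defined below, let X⁺(−1) be the mapping cone of the chain map D⁺_{−1} : ⊕_{s∈ℤ} A⁺_s → ⊕_{s∈ℤ} B⁺_s (one copy B⁺_s of B⁺ for each s ∈ ℤ) given by D⁺_{−1}({a_s}) = {b_s} with b_s = v⁺_s(a_s) + h⁺_{s+1}(a_{s+1}). Then the homology of X⁺(−1) is isomorphic, as a ℤ[U]-module, to T ⊕ (ℤ[U]/U)⁵. (This computes HF⁺ of −1-surgery on T_{3,4}, i.e. of Σ(3,4,13).) -/

import Mathlib

noncomputable section

/-- Basis elements `y_{l,m}` of the knot Floer complex `C` of the torus knot `T_{3,4}`: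
`l ∈ {1,…,5}` (as `Fin 5`, zero-indexed) and `m ∈ ℤ` (the power of `U`). -/
abbrev CBase : Type := Fin 5 × ℤ

/-- The complex `C` (as a `ℤ[U]`-module): the free abelian group on the basis `y_{l,m}`. -/
abbrev Cm : Type := CBase →₀ ℤ

/-- The Alexander offsets `(j₁,…,j₅) = (3,2,0,−2,−3)`;
`y_{l,m}` has filtration level `(−m, −m + j_l)`. -/
def jval : Fin 5 → ℤ := ![3, 2, 0, -2, -3]

/-- The `U`-action on `C`: `U·y_{l,m} = y_{l,m+1}`. -/
def UC : AddMonoid.End Cm :=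
  Finsupp.liftAddHom fun p => Finsupp.singleAddHom (p.1, p.2 + 1)

/-- Multiplication by `U^s` (for any `s ∈ ℤ`): `y_{l,m} ↦ y_{l,m+s}`. -/
def shiftC (s : ℤ) : AddMonoid.End Cm :=
  Finsupp.liftAddHom fun p => Finsupp.singleAddHom (p.1, p.2 + s)

/-- The chain isomorphism `C{j ≥ 0} → C{i ≥ 0}` (extended to all of `C`), induced by
`y_{l,m} ↦ y_{6−l, m−j_l}`. -/
def flipC : AddMonoid.End Cm :=
  Finsupp.liftAddHom fun p => Finsupp.singleAddHom (4 - p.1, p.2 - jval p.1)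

/-- The differential on `C`: `∂y_{2,m} = y_{1,m+1} + y_{3,m}`, `∂y_{4,m} = y_{3,m+2} + y_{5,m}`,
and `∂y_{l,m} = 0` for `l ∈ {1,3,5}`. -/
def dC : AddMonoid.End Cm :=
  Finsupp.liftAddHom fun p =>
    if p.1 = (1 : Fin 5) then
      Finsupp.singleAddHom ((0 : Fin 5), p.2 + 1) + Finsupp.singleAddHom ((2 : Fin 5), p.2)
    else if p.1 = (3 : Fin 5) then
      Finsupp.singleAddHom ((2 : Fin 5), p.2 + 2) + Finsupp.singleAddHom ((4 : Fin 5), p.2)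
    else 0

/-- For a set `S` of filtration levels closed under increase, the quotient complex `C{S}` is
spanned by the generators whose filtration level lies in `S`; we model it as finitely
supported functions on the corresponding set of basis elements. -/
abbrev SubC (q : CBase → Prop) : Type := {p : CBase // q p} →₀ ℤ

/-- The inclusion of `C{S}` into `C` (as groups). -/
def inclS (q : CBase → Prop) : SubC q →+ Cm :=
  Finsupp.liftAddHom fun p => Finsupp.singleAddHom p.1

/-- The projection of `C` onto `C{S}`, killing all other generators. -/
def projS (q : CBase → Prop) [DecidablePred q] : Cm →+ SubC q :=
  Finsupp.liftAddHom fun p =>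
    if h : q p then Finsupp.singleAddHom (⟨p, h⟩ : {p : CBase // q p}) else 0

/-- The endomorphism of `C{S}` induced by an endomorphism of `C` (project after applying). -/
def endS (q : CBase → Prop) [DecidablePred q] (φ : AddMonoid.End Cm) :
    AddMonoid.End (SubC q) :=
  (projS q).comp (φ.comp (inclS q))

/-- The basis elements of `B⁺ = C{i ≥ 0}`: those `y_{l,m}` with `−m ≥ 0`. -/
def condB : CBase → Prop := fun p => p.2 ≤ 0

instance : DecidablePred condB := fun p => inferInstanceAs (Decidable (p.2 ≤ 0))

/-- The basis elements of `A⁺_s = C{max(i, j−s) ≥ 0}`: those `y_{l,m}` with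
`−m ≥ 0` or `−m + j_l − s ≥ 0`. -/
def condA (s : ℤ) : CBase → Prop := fun p => p.2 ≤ 0 ∨ p.2 ≤ jval p.1 - s

instance (s : ℤ) : DecidablePred (condA s) := fun p => instDecidableOr

/-- The basis elements of `C{j ≥ s}`: those `y_{l,m}` with `−m + j_l − s ≥ 0`. -/
def condJ (s : ℤ) : CBase → Prop := fun p => p.2 ≤ jval p.1 - s

instance (s : ℤ) : DecidablePred (condJ s) := fun p => inferInstanceAs (Decidable (p.2 ≤ jval p.1 - s))

/-- `B⁺ = C{i ≥ 0}`. -/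
abbrev Bm : Type := SubC condB

/-- `A⁺_s = C{max(i, j−s) ≥ 0}`. -/
abbrev Am (s : ℤ) : Type := SubC (condA s)

/-- The differential on `B⁺`. -/
def dB : AddMonoid.End Bm := endS condB dC

/-- The differential on `A⁺_s`. -/
def dA (s : ℤ) : AddMonoid.End (Am s) := endS (condA s) dC

/-- The `U`-action on `B⁺`. -/
def UB : AddMonoid.End Bm := endS condB UC

/-- The `U`-action on `A⁺_s`. -/
def UA (s : ℤ) : AddMonoid.End (Am s) := endS (condA s) UC

/-- The projection `v⁺_s : A⁺_s → B⁺`. -/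
def vMap (s : ℤ) : Am s →+ Bm := (projS condB).comp (inclS (condA s))

/-- Killing the generators of `C` whose `j`-filtration is `< s`. -/
def killJ (s : ℤ) : AddMonoid.End Cm := (inclS (condJ s)).comp (projS (condJ s))

/-- The map `h⁺_s : A⁺_s → B⁺`: project `A⁺_s → C{j ≥ s}`, multiply by `U^s` to reach
`C{j ≥ 0}`, then apply the chain isomorphism `C{j ≥ 0} → C{i ≥ 0}`. -/
def hMap (s : ℤ) : Am s →+ Bm :=
  (projS condB).comp (flipC.comp ((shiftC s).comp ((killJ s).comp (inclS (condA s)))))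

/-- The `ℤ[U]`-module `T = ℤ[U,U⁻¹]/(U·ℤ[U])`, modelled as `ℕ →₀ ℤ` where the value at `j`
is the coefficient of `U^{-j}`. -/
abbrev TT : Type := ℕ →₀ ℤ

/-- The `U`-action on `T`. -/
def UT : AddMonoid.End TT :=
  Finsupp.liftAddHom fun j => if j = 0 then 0 else Finsupp.singleAddHom (j - 1)

/-- The cycles of a differential `d`. -/
def cyc {M : Type*} [AddCommGroup M] (d : AddMonoid.End M) : AddSubgroup M :=
  AddMonoidHom.ker d

/-- The homology of a complex `(M, d)`: cycles modulo boundaries. -/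
def Hq {M : Type*} [AddCommGroup M] (d : AddMonoid.End M) : Type _ :=
  cyc d ⧸ ((AddMonoidHom.range d).addSubgroupOf (cyc d))

instance {M : Type*} [AddCommGroup M] (d : AddMonoid.End M) : AddCommGroup (Hq d) := by
  unfold Hq; infer_instance

/-- The homology class of a cycle. -/
def hcl {M : Type*} [AddCommGroup M] (d : AddMonoid.End M) (x : M) (hx : x ∈ cyc d) : Hq d :=
  QuotientAddGroup.mk (⟨x, hx⟩ : cyc d)

/-- The Maslov gradings of the generators `x₁,…,x₅`: `(0,−1,−2,−5,−6)`;
`y_{l,m} = U^m·x_l` has degree `gr_l − 2m`. -/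
def grval : Fin 5 → ℤ := ![0, -1, -2, -5, -6]

/-- The sign operator `a ↦ (−1)^{deg a}·a` on `A⁺_s`, negating the generators of odd degree;
it implements the sign `(−1)^{deg a}` in the mapping cone differential. -/
def sgnA (s : ℤ) : AddMonoid.End (Am s) :=
  Finsupp.liftAddHom fun p =>
    (Finsupp.singleAddHom p).comp
      (AddMonoidHom.mulLeft (if Even (grval p.1.1 - 2 * p.1.2) then (1 : ℤ) else -1))

/-- `⊕_{s ∈ ℤ} A⁺_s`. -/
abbrev AS : Type := Π₀ s : ℤ, Am s

/-- `⊕_{s ∈ ℤ} B⁺_s` (one copy of `B⁺` for each `s ∈ ℤ`). -/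
abbrev BS : Type := Π₀ _ : ℤ, Bm

/-- The differential on `⊕_s A⁺_s`. -/
def dAS : AddMonoid.End AS :=
  DFinsupp.sumAddHom fun s => (DFinsupp.singleAddHom (fun t : ℤ => Am t) s).comp (dA s)

/-- The differential on `⊕_s B⁺_s`. -/
def dBS : AddMonoid.End BS :=
  DFinsupp.sumAddHom fun s => (DFinsupp.singleAddHom (fun _ : ℤ => Bm) s).comp dB

/-- The `U`-action on `⊕_s A⁺_s`. -/
def UAS : AddMonoid.End AS :=
  DFinsupp.sumAddHom fun s => (DFinsupp.singleAddHom (fun t : ℤ => Am t) s).comp (UA s)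

/-- The `U`-action on `⊕_s B⁺_s`. -/
def UBS : AddMonoid.End BS :=
  DFinsupp.sumAddHom fun s => (DFinsupp.singleAddHom (fun _ : ℤ => Bm) s).comp UB

/-- The sign operator on `⊕_s A⁺_s`. -/
def sgnAS : AddMonoid.End AS :=
  DFinsupp.sumAddHom fun s => (DFinsupp.singleAddHom (fun t : ℤ => Am t) s).comp (sgnA s)

/-- The chain map `D⁺₋₁ : ⊕_s A⁺_s → ⊕_s B⁺_s`, `(D⁺₋₁ a)_s = v⁺_s(a_s) + h⁺_{s+1}(a_{s+1})`. -/
def Dm1 : AS →+ BS :=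
  DFinsupp.sumAddHom fun s =>
    ((DFinsupp.singleAddHom (fun _ : ℤ => Bm) s).comp (vMap s)) +
    ((DFinsupp.singleAddHom (fun _ : ℤ => Bm) (s - 1)).comp (hMap s))

/-- The mapping cone `X⁺(−1)` of `D⁺₋₁`, with underlying group `(⊕_s A⁺_s) × (⊕_s B⁺_s)`. -/
abbrev Xm1 : Type := AS × BS

/-- The mapping-cone differential `(a, b) ↦ (∂a, ∂b + (−1)^{deg a}·D⁺₋₁(a))`, where the sign
`(−1)^{deg a}` is implemented by the sign operator negating odd-degree generators. -/
def dXm1 : AddMonoid.End Xm1 :=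
  AddMonoidHom.prod (dAS.comp (AddMonoidHom.fst AS BS))
    ((dBS.comp (AddMonoidHom.snd AS BS)) + (Dm1.comp (sgnAS.comp (AddMonoidHom.fst AS BS))))

/-- The `U`-action on the mapping cone. -/
def UXm1 : AddMonoid.End Xm1 :=
  AddMonoidHom.prod (UAS.comp (AddMonoidHom.fst AS BS)) (UBS.comp (AddMonoidHom.snd AS BS))

/-- The `ℤ[U]`-module `T ⊕ (ℤ[U]/U)⁵`, with `U` acting as `U` on `T` and as `0` on `(ℤ[U]/U)⁵ ≅ ℤ⁵`. -/
abbrev W5 : Type := TT × (Fin 5 → ℤ)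

/-- The `U`-action on `T ⊕ (ℤ[U]/U)⁵`. -/
def UW5 : AddMonoid.End W5 :=
  AddMonoidHom.prod (UT.comp (AddMonoidHom.fst TT (Fin 5 → ℤ))) 0

/-- A homomorphism inducing an isomorphism on homology. -/
theorem exists_homology_equiv {M W : Type*} [AddCommGroup M] [AddCommGroup W]
    (d : AddMonoid.End M) (Φ : M →+ W) (hd : ∀ x, Φ (d x) = 0)
    (hker : ∀ x ∈ cyc d, Φ x = 0 → x ∈ AddMonoidHom.range d)
    (hsurj : ∀ w, ∃ x ∈ cyc d, Φ x = w) :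
    ∃ e : Hq d ≃+ W, ∀ (x : M) (hx : x ∈ cyc d), e (hcl d x hx) = Φ x := by
  let N := (AddMonoidHom.range d).addSubgroupOf (cyc d)
  let f : cyc d →+ W := Φ.comp (cyc d).subtype
  have hN : N ≤ f.ker := by
    rintro ⟨x, hx⟩ ⟨y, hy⟩
    have hy' : d y = x := hy
    change Φ x = 0
    rw [← hy', hd]
  let g : (cyc d ⧸ N) →+ W := QuotientAddGroup.lift N f hN
  have hg : Function.Bijective g := by
    constructor
    · rw [injective_iff_map_eq_zero]
      intro a
      induction a using QuotientAddGroup.induction_on with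
      | H z =>
        intro hz
        exact (QuotientAddGroup.eq_zero_iff z).2 (hker z.1 z.2 hz)
    · intro w
      obtain ⟨x, hx, rfl⟩ := hsurj w
      exact ⟨QuotientAddGroup.mk ⟨x, hx⟩, rfl⟩
  exact ⟨AddEquiv.ofBijective g hg, fun x hx => rfl⟩

/-- The image in `C{S}` of the generator `p` of `C`. -/
def genS (q : CBase → Prop) [DecidablePred q] (p : CBase) : SubC q :=
  projS q (Finsupp.single p 1)

/-- The subgroup of `C{S}` spanned by the generators of even degree. -/
def evenS (q : CBase → Prop) : AddSubgroup (SubC q) where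
  carrier := {x | ∀ p, (p.1.1 = 1 ∨ p.1.1 = 3) → x p = 0}
  zero_mem' := fun _ _ => rfl
  add_mem' := fun {x y} hx hy p hp => by simp [hx p hp, hy p hp]
  neg_mem' := fun {x} hx p hp => by simp [hx p hp]

/-- The element `U^{-n}` of `T`, understood to vanish for `n < 0`. -/
def tau (n : ℤ) : TT := if 0 ≤ n then Finsupp.single n.toNat 1 else 0

/-- The image of a generator of `C` in `ℤ[U,U⁻¹]/(U^{c+1})`, identified with `T`. -/
def genT (c : ℤ) (p : CBase) : TT :=
  ![-tau (c - (p.2 - 1)), 0, tau (c - p.2), 0, -tau (c - (p.2 + 2))] p.1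

/-- The quotient map from `C` to its homology modulo `U^{c+1}`. -/
def projT (c : ℤ) : Cm →+ TT :=
  Finsupp.liftAddHom fun p => zmultiplesHom TT (genT c p)

/-- The largest `m` for which `y_{3,m}` is homologically nontrivial in `A⁺_s`. -/
def cutoff (s : ℤ) : ℤ := min (max (-1) (2 - s)) (min (max 0 (-s)) (max 2 (-1 - s)))

section Generators

variable (q : CBase → Prop) [DecidablePred q]

theorem single_eq_genS (p : {p // q p}) : (Finsupp.single p 1 : SubC q) = genS q p.1 := by
  simp [genS, projS, p.2]

theorem genS_of_not {p : CBase} (hp : ¬ q p) : genS q p = 0 := by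
  simp [genS, projS, hp]

theorem inclS_genS (p : CBase) :
    inclS q (genS q p) = if q p then Finsupp.single p 1 else 0 := by
  by_cases hp : q p <;> simp [genS, projS, inclS, hp]

theorem projS_inclS (x : SubC q) : projS q (inclS q x) = x := by
  suffices h : (projS q).comp (inclS q) = AddMonoidHom.id _ from DFunLike.congr_fun h x
  ext p : 2
  simp [projS, inclS, p.2]

theorem inclS_apply (x : SubC q) (p : CBase) :
    inclS q x p = if h : q p then x ⟨p, h⟩ else 0 := by
  induction x using Finsupp.induction_linear with
  | zero => simp
  | add x y hx hy => rw [map_add, Finsupp.add_apply, hx, hy]; split_ifs <;> simp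
  | single r a =>
    by_cases h : q p
    · simp [inclS, h, Finsupp.single_apply, Subtype.ext_iff]
    · have : r.1 ≠ p := fun e => h (e ▸ r.2)
      simp [inclS, h, this]

theorem projS_apply (f : Cm) (p : {p // q p}) : projS q f p = f p.1 := by
  induction f using Finsupp.induction_linear with
  | zero => simp
  | add x y hx hy => rw [map_add, Finsupp.add_apply, hx, hy, Finsupp.add_apply]
  | single r a =>
    by_cases h : q r
    · simp [projS, h, Finsupp.single_apply, Subtype.ext_iff]
    · have : r ≠ p.1 := fun e => h (e ▸ p.2)
      simp [projS, h, this]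

theorem evenS_le {S : AddSubgroup (SubC q)}
    (h : ∀ p, q p → p.1 ≠ 1 → p.1 ≠ 3 → genS q p ∈ S) : evenS q ≤ S := by
  intro x hx
  rw [← Finsupp.sum_single x]
  refine S.sum_mem fun p _ => ?_
  by_cases hp : p.1.1 = 1 ∨ p.1.1 = 3
  · rw [hx p hp, Finsupp.single_zero]; exact S.zero_mem
  · push Not at hp
    have : (Finsupp.single p (x p) : SubC q) = x p • genS q p.1 := by
      rw [← single_eq_genS, Finsupp.smul_single, smul_eq_mul, mul_one]
    change Finsupp.single p (x p) ∈ S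
    rw [this]
    exact S.zsmul_mem (h _ p.2 hp.1 hp.2) _

theorem genS_mem_evenS {p : CBase} (h1 : p.1 ≠ 1) (h3 : p.1 ≠ 3) : genS q p ∈ evenS q := by
  intro r hr
  have : p ≠ r.1 := by rintro rfl; tauto
  rw [genS, projS_apply, Finsupp.single_apply, if_neg this]

theorem hom_ext_genS {M : Type*} [AddCommGroup M] {f g : SubC q →+ M}
    (h : ∀ p, q p → f (genS q p) = g (genS q p)) : f = g := by
  ext p
  simpa [single_eq_genS] using h p.1 p.2

end Generators

/-- A group endomorphism viewed as a homomorphism. -/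
def asHom {M : Type*} [AddCommGroup M] (f : AddMonoid.End M) : M →+ M := f

theorem asHom_apply {M : Type*} [AddCommGroup M] (f : AddMonoid.End M) (x : M) :
    asHom f x = f x := rfl

theorem UT_tau (n : ℤ) : UT (tau n) = tau (n - 1) := by
  rw [← asHom_apply]
  unfold tau UT asHom
  rcases lt_trichotomy n 0 with h | rfl | h
  · rw [if_neg (by omega), if_neg (by omega), map_zero]
  · rw [if_pos le_rfl, if_neg (by omega)]
    exact (Finsupp.liftAddHom_apply_single _ _ _).trans (by simp)
  · rw [if_pos (by omega), if_pos (by omega)]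
    have h1 : n.toNat ≠ 0 := by omega
    have h2 : (n - 1).toNat = n.toNat - 1 := by omega
    exact (Finsupp.liftAddHom_apply_single _ _ _).trans (by simp [h1, h2])

theorem UT_pow_tau (k : ℕ) (n : ℤ) : (UT ^ k) (tau n) = tau (n - k) := by
  induction k generalizing n with
  | zero => rw [Nat.cast_zero, sub_zero]; rfl
  | succ k ih =>
    rw [pow_succ]
    change (UT ^ k) (UT (tau n)) = _
    rw [UT_tau, ih]
    congr 1; push_cast; ring

theorem projT_single (c : ℤ) (p : CBase) : projT c (Finsupp.single p 1) = genT c p := by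
  simp [projT]

theorem hom_ext_single {M : Type*} [AddCommGroup M] {f g : Cm →+ M}
    (h : ∀ p, f (Finsupp.single p 1) = g (Finsupp.single p 1)) : f = g := by
  ext p
  simpa using h p

theorem UT_pow_projT (c : ℤ) (k : ℕ) (x : Cm) : (UT ^ k) (projT c x) = projT (c - k) x := by
  suffices h : (asHom (UT ^ k)).comp (projT c) = projT (c - k) from
    DFunLike.congr_fun h x
  refine hom_ext_single fun ⟨l, m⟩ => ?_
  rw [AddMonoidHom.comp_apply, asHom_apply, projT_single, projT_single]
  fin_cases l <;> simp [genT, UT_pow_tau, -AddMonoid.End.coe_pow] <;> congr 1 <;> ring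

theorem UC_single (p : CBase) :
    UC (Finsupp.single p 1) = Finsupp.single (p.1, p.2 + 1) 1 :=
  Finsupp.liftAddHom_apply_single _ _ _

theorem shiftC_single (s : ℤ) (p : CBase) :
    shiftC s (Finsupp.single p 1) = Finsupp.single (p.1, p.2 + s) 1 :=
  Finsupp.liftAddHom_apply_single _ _ _

theorem flipC_single (p : CBase) :
    flipC (Finsupp.single p 1) = Finsupp.single (4 - p.1, p.2 - jval p.1) 1 :=
  Finsupp.liftAddHom_apply_single _ _ _

theorem dC_single_one (m : ℤ) :
    dC (Finsupp.single (1, m) 1) = Finsupp.single (0, m + 1) 1 + Finsupp.single (2, m) 1 :=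
  (Finsupp.liftAddHom_apply_single _ _ _).trans (by simp)

theorem dC_single_three (m : ℤ) :
    dC (Finsupp.single (3, m) 1) = Finsupp.single (2, m + 2) 1 + Finsupp.single (4, m) 1 :=
  (Finsupp.liftAddHom_apply_single _ _ _).trans (by simp)

theorem dC_single_even {p : CBase} (h1 : p.1 ≠ 1) (h3 : p.1 ≠ 3) :
    dC (Finsupp.single p 1) = 0 :=
  (Finsupp.liftAddHom_apply_single _ _ _).trans (by simp [h1, h3])

theorem projT_UC (c : ℤ) (x : Cm) : projT c (UC x) = UT (projT c x) := by
  suffices h : (projT c).comp (asHom UC) = (asHom UT).comp (projT c) from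
    DFunLike.congr_fun h x
  refine hom_ext_single fun ⟨l, m⟩ => ?_
  rw [AddMonoidHom.comp_apply, AddMonoidHom.comp_apply, asHom_apply, asHom_apply, UC_single,
    projT_single, projT_single]
  fin_cases l <;> simp [genT, UT_tau] <;> congr 1 <;> ring

theorem projT_shiftC (c s : ℤ) (x : Cm) : projT c (shiftC s x) = projT (c - s) x := by
  suffices h : (projT c).comp (asHom (shiftC s)) = projT (c - s) from DFunLike.congr_fun h x
  refine hom_ext_single fun ⟨l, m⟩ => ?_
  rw [AddMonoidHom.comp_apply, asHom_apply, shiftC_single, projT_single, projT_single]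
  fin_cases l <;> simp [genT] <;> congr 1 <;> ring

theorem projT_flipC (c : ℤ) (x : Cm) : projT c (flipC x) = projT c x := by
  suffices h : (projT c).comp (asHom flipC) = projT c from DFunLike.congr_fun h x
  refine hom_ext_single fun ⟨l, m⟩ => ?_
  rw [AddMonoidHom.comp_apply, asHom_apply, flipC_single, projT_single, projT_single]
  fin_cases l <;> simp [genT, jval, show (4 : Fin 5) - 1 = 3 from rfl,
    show (4 : Fin 5) - 2 = 2 from rfl, show (4 : Fin 5) - 3 = 1 from rfl] <;> congr 1 <;> ring

theorem projT_dC (c : ℤ) (x : Cm) : projT c (dC x) = 0 := by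
  suffices h : (projT c).comp (asHom dC) = 0 from DFunLike.congr_fun h x
  refine hom_ext_single fun ⟨l, m⟩ => ?_
  rw [AddMonoidHom.comp_apply, AddMonoidHom.zero_apply, asHom_apply]
  by_cases h1 : l = 1
  · subst h1; rw [dC_single_one, map_add, projT_single, projT_single]; simp [genT]
  by_cases h3 : l = 3
  · subst h3; rw [dC_single_three, map_add, projT_single, projT_single]; simp [genT]
  rw [dC_single_even h1 h3, map_zero]

theorem dC_apply (f : Cm) (m : ℤ) : dC f (0, m) = f (1, m - 1) ∧
    dC f (2, m) = f (1, m) + f (3, m - 2) ∧ dC f (4, m) = f (3, m) := by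
  have key (r : CBase) (g : Cm →+ ℤ)
      (h : ∀ p, dC (Finsupp.single p 1) r = g (Finsupp.single p 1)) : dC f r = g f :=
    DFunLike.congr_fun (hom_ext_single h : (Finsupp.applyAddHom r).comp (asHom dC) = g) f
  refine ⟨key _ (Finsupp.applyAddHom _) ?_,
    key _ (Finsupp.applyAddHom _ + Finsupp.applyAddHom _) ?_,
    key _ (Finsupp.applyAddHom _) ?_⟩ <;> rintro ⟨l, k⟩ <;>
  · by_cases h1 : l = 1
    · subst h1; rw [dC_single_one]; simp [Finsupp.single_apply]; try grind
    by_cases h3 : l = 3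
    · subst h3; rw [dC_single_three]; simp [Finsupp.single_apply]; try grind
    rw [dC_single_even h1 h3]; simp [h1, h3]

theorem dC_apply_odd (f : Cm) {r : CBase} (hr : r.1 = 1 ∨ r.1 = 3) : dC f r = 0 := by
  suffices h : (Finsupp.applyAddHom r).comp (asHom dC) = 0 from DFunLike.congr_fun h f
  obtain ⟨i, n⟩ := r
  refine hom_ext_single fun ⟨l, m⟩ => ?_
  change dC (Finsupp.single (l, m) 1) (i, n) = 0
  by_cases h1 : l = 1
  · subst h1; rw [dC_single_one]; rcases hr with rfl | rfl <;> simp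
  by_cases h3 : l = 3
  · subst h3; rw [dC_single_three]; rcases hr with rfl | rfl <;> simp
  rw [dC_single_even h1 h3]; rfl

theorem tau_of_neg {n : ℤ} (h : n < 0) : tau n = 0 := if_neg (by omega)

theorem genT_cutoff {s : ℤ} {p : CBase} (hp : ¬ condA s p) : genT (cutoff s) p = 0 := by
  obtain ⟨l, m⟩ := p
  simp only [condA, not_or, not_le] at hp
  obtain ⟨h1, h2⟩ := hp
  fin_cases l <;> simp [genT, jval, cutoff] at * <;> apply tau_of_neg <;> omega

theorem genT_condJ {s : ℤ} {p : CBase} (hp : ¬ condJ s p) : genT (-1 - s) p = 0 := by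
  obtain ⟨l, m⟩ := p
  simp only [condJ, not_le] at hp
  fin_cases l <;> simp [genT, jval] at * <;> apply tau_of_neg <;> omega

/-- The map from `C{S}` to `T` realising the homology, where `S` is that of `A⁺_s`. -/
def piS (q : CBase → Prop) (s : ℤ) : SubC q →+ TT := (projT (cutoff s)).comp (inclS q)

/-- The section `U^{-j} ↦ y_{3,c-j}` of `piS`. -/
def sigmaS (q : CBase → Prop) [DecidablePred q] (s : ℤ) : TT →+ SubC q :=
  Finsupp.liftAddHom fun j => zmultiplesHom _ (genS q (2, cutoff s - j))

section Homology

variable {q : CBase → Prop} [DecidablePred q] {s : ℤ}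

theorem piS_projS (hq : ∀ p, q p ↔ condA s p) (f : Cm) :
    piS q s (projS q f) = projT (cutoff s) f := by
  suffices h : (piS q s).comp (projS q) = projT (cutoff s) from DFunLike.congr_fun h f
  refine hom_ext_single fun p => ?_
  change projT _ (inclS q (genS q p)) = _
  rw [inclS_genS, projT_single]
  split_ifs with h
  · rw [projT_single]
  · rw [map_zero, genT_cutoff (mt (hq p).2 h)]

theorem piS_genS (hq : ∀ p, q p ↔ condA s p) (p : CBase) :
    piS q s (genS q p) = genT (cutoff s) p := by
  rw [genS, piS_projS hq, projT_single]

theorem piS_dC (hq : ∀ p, q p ↔ condA s p) (x : SubC q) : piS q s (endS q dC x) = 0 :=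
  (piS_projS hq _).trans (projT_dC _ _)

theorem piS_UC (hq : ∀ p, q p ↔ condA s p) (x : SubC q) :
    piS q s (endS q UC x) = UT (piS q s x) :=
  (piS_projS hq _).trans (projT_UC _ _)

theorem endS_dC_genS {p : CBase} (hp : q p) :
    endS q dC (genS q p) = projS q (dC (Finsupp.single p 1)) := by
  change projS q (dC (inclS q (genS q p))) = _
  rw [inclS_genS, if_pos hp]

theorem endS_dC_genS_one {m : ℤ} (h : q (1, m)) :
    endS q dC (genS q (1, m)) = genS q (0, m + 1) + genS q (2, m) := by
  rw [endS_dC_genS h, dC_single_one, map_add]; rfl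

theorem endS_dC_genS_three {m : ℤ} (h : q (3, m)) :
    endS q dC (genS q (3, m)) = genS q (2, m + 2) + genS q (4, m) := by
  rw [endS_dC_genS h, dC_single_three, map_add]; rfl

theorem evenS_le_ker : evenS q ≤ cyc (endS q dC) :=
  evenS_le q fun p hp h1 h3 => by
    change endS q dC (genS q p) = 0
    rw [endS_dC_genS hp, dC_single_even h1 h3, map_zero]

theorem cyc_le_evenS (hq : ∀ p, q p ↔ condA s p) : cyc (endS q dC) ≤ evenS q := by
  intro x hx
  have hx' : projS q (dC (inclS q x)) = 0 := hx
  set f := inclS q x with hf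
  have h0 (p : CBase) (hp : ¬ condA s p) : f p = 0 := by
    rw [hf, inclS_apply, dif_neg (mt (hq p).1 hp)]
  have hd (p : CBase) (hp : condA s p) : dC f p = 0 := by
    have h := projS_apply q (dC f) ⟨p, (hq p).2 hp⟩
    rw [hx'] at h
    exact h.symm
  have h1 (m : ℤ) : f (1, m) = 0 := by
    by_cases A0 : condA s (0, m + 1)
    · simpa [dC_apply] using hd _ A0
    by_cases A1 : condA s (1, m)
    swap
    · exact h0 _ A1
    have A2 : condA s (2, m) := by simp [condA, jval] at *; omega
    have A4 : condA s (4, m - 2) := by simp [condA, jval] at *; omega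
    have e2 := hd _ A2
    have e4 := hd _ A4
    rw [(dC_apply f _).2.1] at e2
    rw [(dC_apply f _).2.2] at e4
    rwa [e4, add_zero] at e2
  have h3 (m : ℤ) : f (3, m) = 0 := by
    by_cases A4 : condA s (4, m)
    · simpa [dC_apply] using hd _ A4
    by_cases A3 : condA s (3, m)
    swap
    · exact h0 _ A3
    have A2 : condA s (2, m + 2) := by simp [condA, jval] at *; omega
    have e2 := hd _ A2
    rwa [(dC_apply f _).2.1, h1, zero_add, add_sub_cancel_right] at e2
  rintro ⟨⟨l, m⟩, hp⟩ hl
  have hxp : f (l, m) = x ⟨(l, m), hp⟩ := by rw [hf, inclS_apply, dif_pos hp]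
  rw [← hxp]
  rcases hl with hl | hl <;> simp only at hl <;> subst hl
  exacts [h1 m, h3 m]

theorem sigmaS_tau (n : ℤ) :
    sigmaS q s (tau n) = if 0 ≤ n then genS q (2, cutoff s - n) else 0 := by
  unfold tau
  split_ifs with h
  · simp [sigmaS, h]
  · rw [map_zero]

theorem genS_two_sub_mem (hq : ∀ p, q p ↔ condA s p) (m : ℤ) :
    genS q (2, m) - sigmaS q s (tau (cutoff s - m)) ∈ AddMonoidHom.range (endS q dC) := by
  rw [sigmaS_tau]
  split_ifs with h
  · rw [sub_sub_cancel, sub_self]; exact zero_mem _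
  by_cases hm : q (2, m)
  swap
  · rw [genS_of_not q hm, sub_zero]; exact zero_mem _
  have h2 := (hq _).1 hm
  by_cases h0 : q (0, m + 1)
  · have h4 : ¬ q (4, m - 2) := by
      rw [hq] at h0 ⊢; simp [condA, cutoff, jval] at *; omega
    have h3 : q (3, m - 2) := by
      rw [hq] at h0 ⊢; simp [condA, cutoff, jval] at *; omega
    refine ⟨genS q (3, m - 2), (endS_dC_genS_three h3).trans ?_⟩
    rw [genS_of_not q h4, sub_add_cancel, add_zero, sub_zero]
  · have h3 : q (1, m) := by
      rw [hq] at h0 ⊢; simp [condA, cutoff, jval] at *; omega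
    refine ⟨genS q (1, m), (endS_dC_genS_one h3).trans ?_⟩
    rw [genS_of_not q h0, zero_add, sub_zero]

theorem sub_sigmaS_piS_mem (hq : ∀ p, q p ↔ condA s p) {x : SubC q} (hx : x ∈ evenS q) :
    x - sigmaS q s (piS q s x) ∈ AddMonoidHom.range (endS q dC) := by
  have key : evenS q ≤ (AddMonoidHom.range (endS q dC)).comap
      (AddMonoidHom.id _ - (sigmaS q s).comp (piS q s)) := by
    refine evenS_le q fun p hp h1 h3 => ?_
    change genS q p - sigmaS q s (piS q s (genS q p)) ∈ AddMonoidHom.range (endS q dC)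
    rw [piS_genS hq]
    obtain ⟨l, m⟩ := p
    have hp' := (hq _).1 hp
    fin_cases l <;> simp [genT] at h1 h3 ⊢
    · have h : q (1, m - 1) := by rw [hq]; simp [condA, jval] at *; omega
      have e := endS_dC_genS_one h
      rw [sub_add_cancel] at e
      have := sub_mem (AddMonoidHom.mem_range.2 ⟨_, e⟩) (genS_two_sub_mem hq (m - 1))
      convert this using 1
      abel
    · exact genS_two_sub_mem hq m
    · have h : q (3, m) := by rw [hq]; simp [condA, jval] at *; omega
      have := sub_mem (AddMonoidHom.mem_range.2 ⟨_, endS_dC_genS_three h⟩)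
        (genS_two_sub_mem hq (m + 2))
      convert this using 1
      abel
  exact key hx

theorem mem_range_of_piS_eq_zero (hq : ∀ p, q p ↔ condA s p) {x : SubC q} (hx : x ∈ evenS q)
    (h : piS q s x = 0) : x ∈ AddMonoidHom.range (endS q dC) := by
  simpa [h] using sub_sigmaS_piS_mem hq hx

theorem cutoff_le (s : ℤ) : -1 ≤ cutoff s ∧ -1 ≤ cutoff s + s := by
  unfold cutoff; omega

theorem piS_genS_two (hq : ∀ p, q p ↔ condA s p) (n : ℤ) :
    piS q s (genS q (2, cutoff s - n)) = tau n := by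
  rw [piS_genS hq]; simp [genT]

end Homology

theorem condB_iff (p : CBase) : condB p ↔ condA 3 p := by
  obtain ⟨l, m⟩ := p
  fin_cases l <;> simp [condB, condA, jval] <;> omega

theorem cutoff_three : cutoff 3 = -1 := by decide

theorem piS_vMap (s : ℤ) (a : Am s) :
    piS condB 3 (vMap s a) = (UT ^ (cutoff s + 1).toNat) (piS (condA s) s a) := by
  refine (piS_projS condB_iff _).trans ?_
  change _ = (UT ^ _) (projT _ _)
  rw [UT_pow_projT, cutoff_three]
  congr 2
  have := cutoff_le s; omega

theorem projT_killJ (s : ℤ) (x : Cm) : projT (-1 - s) (killJ s x) = projT (-1 - s) x := by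
  suffices h : (projT (-1 - s)).comp (asHom (killJ s)) = projT (-1 - s) from
    DFunLike.congr_fun h x
  refine hom_ext_single fun p => ?_
  change projT _ (inclS _ (genS (condJ s) p)) = _
  rw [inclS_genS, projT_single]
  split_ifs with h
  · rw [projT_single]
  · rw [map_zero, genT_condJ h]

theorem piS_hMap (s : ℤ) (a : Am s) :
    piS condB 3 (hMap s a) = (UT ^ (cutoff s + s + 1).toNat) (piS (condA s) s a) := by
  refine (piS_projS condB_iff _).trans ?_
  change projT _ (flipC (shiftC s (killJ s _))) = (UT ^ _) (projT _ _)
  rw [projT_flipC, projT_shiftC, UT_pow_projT, cutoff_three, projT_killJ]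
  congr 2
  have := cutoff_le s; omega

theorem vMap_genS {s : ℤ} {p : CBase} (hp : condA s p) :
    vMap s (genS (condA s) p) = genS condB p := by
  change projS condB (inclS _ _) = _
  rw [inclS_genS, if_pos hp]; rfl

theorem hMap_genS {s : ℤ} {p : CBase} (hp : condA s p) :
    hMap s (genS (condA s) p) = genS condB (4 - p.1, p.2 + s - jval p.1) := by
  change projS condB (flipC (shiftC s (inclS _ (projS _ (inclS _ _))))) = _
  rw [inclS_genS, if_pos hp]
  change projS condB (flipC (shiftC s (inclS _ (genS _ _)))) = _
  rw [inclS_genS]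
  split_ifs with h
  · rw [shiftC_single, flipC_single]; rfl
  · rw [map_zero, map_zero, map_zero, genS_of_not]
    simp only [condJ, condB] at *; omega

theorem four_sub_ne {l : Fin 5} (h1 : l ≠ 1) (h3 : l ≠ 3) : 4 - l ≠ 1 ∧ 4 - l ≠ 3 := by
  revert l; decide

theorem evenS_le_comap_hMap (s : ℤ) : evenS (condA s) ≤ (evenS condB).comap (hMap s) :=
  evenS_le _ fun p hp h1 h3 => by
    rw [AddSubgroup.mem_comap, hMap_genS hp]
    exact genS_mem_evenS _ (four_sub_ne h1 h3).1 (four_sub_ne h1 h3).2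

theorem evenS_le_comap_vMap (s : ℤ) : evenS (condA s) ≤ (evenS condB).comap (vMap s) :=
  evenS_le _ fun p hp h1 h3 => by
    rw [AddSubgroup.mem_comap, vMap_genS hp]
    exact genS_mem_evenS _ h1 h3

theorem evenS_le_map_vMap (s : ℤ) : evenS condB ≤ (evenS (condA s)).map (vMap s) :=
  evenS_le _ fun p hp h1 h3 =>
    ⟨genS _ p, genS_mem_evenS _ h1 h3, vMap_genS (Or.inl hp)⟩

theorem jval_four_sub (l : Fin 5) : jval (4 - l) = - jval l := by
  fin_cases l <;> rfl

theorem evenS_le_map_hMap (s : ℤ) : evenS condB ≤ (evenS (condA s)).map (hMap s) :=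
  evenS_le _ fun p hp h1 h3 => by
    refine ⟨genS _ (4 - p.1, p.2 - s - jval p.1),
      genS_mem_evenS _ (four_sub_ne h1 h3).1 (four_sub_ne h1 h3).2, (hMap_genS ?_).trans ?_⟩
    · simp only [condA, condB, jval_four_sub] at *; omega
    · congr 1
      ext1
      · simp
      · simp only [jval_four_sub]; ring

theorem grval_even {p : CBase} (h1 : p.1 ≠ 1) (h3 : p.1 ≠ 3) : Even (grval p.1 - 2 * p.2) := by
  have h : ∀ l : Fin 5, l ≠ 1 → l ≠ 3 → Even (grval l) := by decide
  exact (h p.1 h1 h3).sub (even_two_mul p.2)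

theorem sgnA_genS {s : ℤ} (p : {p // condA s p}) :
    sgnA s (genS (condA s) p.1) =
      (if Even (grval p.1.1 - 2 * p.1.2) then (1 : ℤ) else -1) • genS (condA s) p.1 := by
  rw [← single_eq_genS]
  exact (Finsupp.liftAddHom_apply_single _ _ _).trans (by split_ifs <;> simp)

theorem sgnA_of_mem_evenS {s : ℤ} {a : Am s} (ha : a ∈ evenS (condA s)) : sgnA s a = a := by
  have key : evenS (condA s) ≤ (asHom (sgnA s)).eqLocus (AddMonoidHom.id _) :=
    evenS_le _ fun p hp h1 h3 => by
      change sgnA s (genS _ p) = genS _ p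
      rw [sgnA_genS ⟨p, hp⟩, if_pos (grval_even h1 h3), one_smul]
  exact key ha

section DirectSums

variable {β γ : ℤ → Type} [∀ s, AddCommGroup (β s)] [∀ s, AddCommGroup (γ s)]

theorem sumAddHom_single_comp_apply (f : ∀ s, β s →+ γ s) (a : Π₀ s, β s) (t : ℤ) :
    DFinsupp.sumAddHom (fun s => (DFinsupp.singleAddHom γ s).comp (f s)) a t = f t (a t) := by
  induction a using DFinsupp.induction with
  | h0 => simp
  | ha i b a _ _ ih =>
    rw [map_add, DFinsupp.add_apply, ih, DFinsupp.add_apply, map_add, DFinsupp.sumAddHom_single]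
    by_cases h : i = t
    · subst h; simp
    · simp [DFinsupp.single_eq_of_ne (Ne.symm h)]

theorem mem_of_single_mem {S : AddSubgroup (Π₀ s, β s)} (a : Π₀ s, β s)
    (h : ∀ s, DFinsupp.single s (a s) ∈ S) : a ∈ S := by
  classical
  rw [← DFinsupp.sum_single (f := a)]
  exact S.sum_mem fun s _ => h s

end DirectSums

theorem Dm1_single (s : ℤ) (a : Am s) :
    Dm1 (DFinsupp.single s a) =
      DFinsupp.single s (vMap s a) + DFinsupp.single (s - 1) (hMap s a) :=
  DFinsupp.sumAddHom_single _ _ _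

theorem Dm1_apply (a : AS) (t : ℤ) :
    Dm1 a t = vMap t (a t) + hMap (t + 1) (a (t + 1)) := by
  induction a using DFinsupp.induction with
  | h0 => simp
  | ha i b a _ _ ih =>
    rw [map_add, DFinsupp.add_apply, ih, DFinsupp.add_apply, DFinsupp.add_apply, map_add, map_add,
      Dm1_single, DFinsupp.add_apply]
    have h1 : (DFinsupp.single i (vMap i b) : BS) t =
        vMap t ((DFinsupp.single i b : AS) t) := by
      by_cases h : i = t
      · subst h; simp
      · simp [DFinsupp.single_eq_of_ne (Ne.symm h)]
    have h2 : (DFinsupp.single (i - 1) (hMap i b) : BS) t =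
        hMap (t + 1) ((DFinsupp.single i b : AS) (t + 1)) := by
      by_cases h : i = t + 1
      · subst h
        rw [add_sub_cancel_right, DFinsupp.single_eq_same, DFinsupp.single_eq_same]
      · rw [DFinsupp.single_eq_of_ne (by omega), DFinsupp.single_eq_of_ne (Ne.symm h), map_zero]
    rw [h1, h2]
    abel

theorem dXm1_mk (a : AS) (b : BS) : dXm1 (a, b) = (dAS a, dBS b + Dm1 (sgnAS a)) := rfl

theorem dBS_single (s : ℤ) (b : Bm) :
    dBS (DFinsupp.single s b) = DFinsupp.single s (dB b) :=
  DFinsupp.sumAddHom_single _ _ _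

theorem UBS_single (s : ℤ) (b : Bm) :
    UBS (DFinsupp.single s b) = DFinsupp.single s (UB b) :=
  DFinsupp.sumAddHom_single _ _ _

theorem dAS_single (s : ℤ) (a : Am s) :
    dAS (DFinsupp.single s a) = DFinsupp.single s (dA s a) :=
  DFinsupp.sumAddHom_single _ _ _

theorem sgnAS_single (s : ℤ) (a : Am s) :
    sgnAS (DFinsupp.single s a) = DFinsupp.single s (sgnA s a) :=
  DFinsupp.sumAddHom_single _ _ _

theorem dXm1_single_of_even {s : ℤ} {a : Am s} (ha : a ∈ evenS (condA s)) :
    dXm1 (DFinsupp.single s a, 0) =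
      (0, DFinsupp.single s (vMap s a) + DFinsupp.single (s - 1) (hMap s a)) := by
  have h : dA s a = 0 := evenS_le_ker ha
  rw [dXm1_mk, dAS_single, h, DFinsupp.single_zero, sgnAS_single, sgnA_of_mem_evenS ha,
    Dm1_single, map_zero, zero_add]

/-- The exponent `s(s+1)/2`. -/
def tri (s : ℤ) : ℤ := s * (s + 1) / 2

theorem tri_nonneg (s : ℤ) : 0 ≤ tri s := by
  refine Int.ediv_nonneg ?_ (by norm_num)
  rcases le_or_gt 0 s with h | h <;> nlinarith

theorem tri_sub_one (s : ℤ) : tri (s - 1) + s = tri s := by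
  unfold tri
  rw [← Int.add_mul_ediv_right _ _ (by norm_num)]
  congr 1; ring

/-- The map `(b_s) ↦ ∑ (-1)^s U^{s(s+1)/2} b_s` identifying the cokernel of `D⁺₋₁` with `T`. -/
def phiT : BS →+ TT :=
  DFinsupp.sumAddHom fun s =>
    (s.negOnePow : ℤ) • (asHom (UT ^ (tri s).toNat)).comp (piS condB 3)

theorem phiT_single (s : ℤ) (b : Bm) :
    phiT (DFinsupp.single s b) = (s.negOnePow : ℤ) • (UT ^ (tri s).toNat) (piS condB 3 b) :=
  DFinsupp.sumAddHom_single _ _ _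

theorem UT_pow_add (j k : ℕ) (t : TT) : (UT ^ j) ((UT ^ k) t) = (UT ^ (j + k)) t := by
  rw [pow_add]; rfl

theorem phiT_Dm1 (a : AS) : phiT (Dm1 a) = 0 := by
  suffices h : phiT.comp Dm1 = 0 from DFunLike.congr_fun h a
  refine DFinsupp.addHom_ext fun s x => ?_
  rw [AddMonoidHom.comp_apply, Dm1_single, map_add, phiT_single, phiT_single, piS_vMap, piS_hMap,
    UT_pow_add, UT_pow_add]
  have h1 := tri_nonneg s
  have h2 := tri_nonneg (s - 1)
  have h3 := tri_sub_one s
  have h4 := cutoff_le s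
  have h5 : (tri (s - 1)).toNat + (cutoff s + s + 1).toNat =
      (tri s).toNat + (cutoff s + 1).toNat := by omega
  rw [h5, Int.negOnePow_sub, Int.negOnePow_one]
  simp

theorem phiT_dBS (b : BS) : phiT (dBS b) = 0 := by
  suffices h : phiT.comp (asHom dBS) = 0 from DFunLike.congr_fun h b
  refine DFinsupp.addHom_ext fun s x => ?_
  rw [AddMonoidHom.comp_apply, asHom_apply, dBS_single, phiT_single]
  have : piS condB 3 (dB x) = 0 := piS_dC condB_iff x
  rw [this, map_zero, smul_zero]; rfl

theorem phiT_UBS (b : BS) : phiT (UBS b) = UT (phiT b) := by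
  suffices h : phiT.comp (asHom UBS) = (asHom UT).comp phiT from DFunLike.congr_fun h b
  refine DFinsupp.addHom_ext fun s x => ?_
  rw [AddMonoidHom.comp_apply, AddMonoidHom.comp_apply, asHom_apply, asHom_apply, UBS_single,
    phiT_single, phiT_single, map_zsmul]
  have : piS condB 3 (UB x) = UT (piS condB 3 x) := piS_UC condB_iff x
  rw [this]
  congr 1
  change (UT ^ _ * UT) _ = (UT * UT ^ _) _
  rw [← pow_succ, ← pow_succ']

/-- The map `(a_s) ↦ π_s(a_s)` to `T`. -/
def piAS (s : ℤ) : AS →+ TT :=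
  (piS (condA s) s).comp (DFinsupp.evalAddMonoidHom s)

theorem piAS_apply (s : ℤ) (a : AS) : piAS s a = piS (condA s) s (a s) := rfl

/-- The map from `X⁺(−1)` to `T ⊕ ℤ⁵` that induces the isomorphism on homology. -/
def phi : Xm1 →+ W5 :=
  (phiT.comp (AddMonoidHom.snd AS BS)).prod
    ((AddMonoidHom.pi fun i : Fin 5 =>
      (Finsupp.applyAddHom 0).comp (piAS ((i : ℕ) - 2))).comp (AddMonoidHom.fst AS BS))

theorem phi_mk (a : AS) (b : BS) :
    phi (a, b) = (phiT b, fun i : Fin 5 => piAS ((i : ℕ) - 2) a 0) := rfl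

theorem dAS_apply (a : AS) (s : ℤ) : dAS a s = dA s (a s) := sumAddHom_single_comp_apply _ _ _

theorem dBS_apply (b : BS) (s : ℤ) : dBS b s = dB (b s) := sumAddHom_single_comp_apply _ _ _

theorem UAS_apply (a : AS) (s : ℤ) : UAS a s = UA s (a s) := sumAddHom_single_comp_apply _ _ _

theorem sgnAS_apply (a : AS) (s : ℤ) : sgnAS a s = sgnA s (a s) :=
  sumAddHom_single_comp_apply _ _ _

theorem piAS_dAS (s : ℤ) (a : AS) : piAS s (dAS a) = 0 := by
  rw [piAS_apply, dAS_apply]; exact piS_dC (fun _ => Iff.rfl) _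

theorem piAS_UAS (s : ℤ) (a : AS) : piAS s (UAS a) = UT (piAS s a) := by
  rw [piAS_apply, UAS_apply]; exact piS_UC (fun _ => Iff.rfl) _

theorem phi_dXm1 (x : Xm1) : phi (dXm1 x) = 0 := by
  obtain ⟨a, b⟩ := x
  rw [dXm1_mk, phi_mk, map_add, phiT_dBS, phiT_Dm1, add_zero]
  ext1
  · rfl
  · funext i
    simp only [piAS_dAS]; rfl

section Cycles

variable {a : AS} {b : BS}

theorem mem_evenS_of_cycle (h : (a, b) ∈ cyc dXm1) (s : ℤ) : a s ∈ evenS (condA s) := by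
  have h1 : dAS a = 0 := congrArg Prod.fst (show dXm1 (a, b) = 0 from h)
  refine cyc_le_evenS (fun _ => Iff.rfl) ?_
  change dA s (a s) = 0
  rw [← dAS_apply, h1]; rfl

theorem piAS_recurrence (h : (a, b) ∈ cyc dXm1) (s : ℤ) :
    (UT ^ (cutoff s + 1).toNat) (piAS s a) +
      (UT ^ (cutoff (s + 1) + (s + 1) + 1).toNat) (piAS (s + 1) a) = 0 := by
  have h2 : dBS b + Dm1 (sgnAS a) = 0 := congrArg Prod.snd (show dXm1 (a, b) = 0 from h)
  have h3 := congrArg (piS condB 3) (DFunLike.congr_fun h2 s)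
  rw [DFinsupp.add_apply, dBS_apply, Dm1_apply, sgnAS_apply, sgnAS_apply,
    sgnA_of_mem_evenS (mem_evenS_of_cycle h s), sgnA_of_mem_evenS (mem_evenS_of_cycle h (s + 1)),
    map_add, map_add, piS_vMap, piS_hMap] at h3
  have h4 : piS condB 3 (dB (b s)) = 0 := piS_dC condB_iff _
  rw [h4, zero_add] at h3
  exact h3.trans (map_zero _)

theorem exists_bound (a : AS) : ∃ N : ℕ, ∀ s : ℤ, (N : ℤ) < |s| → piAS s a = 0 := by
  classical
  refine ⟨a.support.sup Int.natAbs, fun s hs => ?_⟩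
  have : s ∉ a.support := fun h => by
    have := Finset.le_sup (f := Int.natAbs) h
    rw [Int.abs_eq_natAbs] at hs
    omega
  rw [piAS_apply, DFinsupp.notMem_support_iff.1 this, map_zero]

theorem piAS_eq_zero_of_three_le (h : (a, b) ∈ cyc dXm1) {s : ℤ} (hs : 3 ≤ s) :
    piAS s a = 0 := by
  obtain ⟨N, hN⟩ := exists_bound a
  have key (k : ℕ) : ∀ s : ℤ, 3 ≤ s → (N : ℤ) < s + k → piAS s a = 0 := by
    induction k with
    | zero => intro s hs hk; exact hN s (by rw [abs_of_nonneg] <;> omega)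
    | succ k ih =>
      intro s hs hk
      have hr := piAS_recurrence h s
      have hc : (cutoff s + 1).toNat = 0 := by unfold cutoff; omega
      rw [ih (s + 1) (by omega) (by push_cast at hk; omega), map_zero, add_zero, hc] at hr
      exact hr
  exact key (N + 1) s hs (by push_cast; omega)

theorem piAS_eq_zero_of_le_neg_three (h : (a, b) ∈ cyc dXm1) {s : ℤ} (hs : s ≤ -3) :
    piAS s a = 0 := by
  obtain ⟨N, hN⟩ := exists_bound a
  have key (k : ℕ) : ∀ s : ℤ, s ≤ -3 → (N : ℤ) < k - s → piAS s a = 0 := by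
    induction k with
    | zero => intro s hs hk; exact hN s (by rw [abs_of_nonpos] <;> omega)
    | succ k ih =>
      intro s hs hk
      have hr := piAS_recurrence h (s - 1)
      have hc : (cutoff s + s + 1).toNat = 0 := by unfold cutoff; omega
      rw [ih (s - 1) (by omega) (by push_cast at hk; omega), map_zero, zero_add, sub_add_cancel,
        hc] at hr
      exact hr
  exact key (N + 1) s hs (by push_cast; omega)

theorem UT_pow_eq_zero {t : TT} (h : UT t = 0) {k : ℕ} (hk : 1 ≤ k) : (UT ^ k) t = 0 := by
  obtain ⟨j, rfl⟩ := Nat.exists_eq_add_of_le hk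
  rw [add_comm, ← UT_pow_add, pow_one, h, map_zero]

theorem UT_piAS (h : (a, b) ∈ cyc dXm1) (s : ℤ) : UT (piAS s a) = 0 := by
  have up (s : ℤ) (hs : cutoff s = 0) (h1 : 1 ≤ cutoff (s + 1) + (s + 1) + 1)
      (h2 : UT (piAS (s + 1) a) = 0) : UT (piAS s a) = 0 := by
    have hr := piAS_recurrence h s
    rw [UT_pow_eq_zero h2 (by omega), add_zero, hs] at hr
    simpa using hr
  have down (s : ℤ) (hs : cutoff s + s = 0) (h1 : 1 ≤ cutoff (s - 1) + 1)
      (h2 : UT (piAS (s - 1) a) = 0) : UT (piAS s a) = 0 := by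
    have hr := piAS_recurrence h (s - 1)
    rw [UT_pow_eq_zero h2 (by omega), zero_add, sub_add_cancel, hs] at hr
    simpa using hr
  by_cases h3 : 3 ≤ s
  · rw [piAS_eq_zero_of_three_le h h3, map_zero]
  by_cases h4 : s ≤ -3
  · rw [piAS_eq_zero_of_le_neg_three h h4, map_zero]
  have t2 : UT (piAS 2 a) = 0 := by
    have hr := piAS_recurrence h 2
    rw [piAS_eq_zero_of_three_le h (s := 2 + 1) (by norm_num), map_zero, add_zero] at hr
    exact hr
  have t1 : UT (piAS 1 a) = 0 := up 1 (by decide) (by decide) t2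
  have t0 : UT (piAS 0 a) = 0 := up 0 (by decide) (by decide) t1
  have s2 : UT (piAS (-2) a) = 0 := by
    have hr := piAS_recurrence h (-3)
    rw [piAS_eq_zero_of_le_neg_three h (s := -3) (by norm_num), map_zero, zero_add] at hr
    exact hr
  have s1 : UT (piAS (-1) a) = 0 := down (-1) (by decide) (by decide) s2
  obtain rfl | rfl | rfl | rfl | rfl : s = -2 ∨ s = -1 ∨ s = 0 ∨ s = 1 ∨ s = 2 := by omega
  all_goals assumption

end Cycles

theorem UT_apply (t : TT) (n : ℕ) : UT t n = t (n + 1) := by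
  suffices h : (Finsupp.applyAddHom n).comp (asHom UT) = Finsupp.applyAddHom (n + 1) from
    DFunLike.congr_fun h t
  ext j
  have : UT (Finsupp.single j 1) = if j = 0 then 0 else Finsupp.single (j - 1) 1 :=
    (Finsupp.liftAddHom_apply_single _ _ _).trans (by split_ifs <;> simp)
  change UT (Finsupp.single j 1) n = (Finsupp.single j 1 : TT) (n + 1)
  rw [this]
  split_ifs with h
  · simp [h]
  · simp only [Finsupp.single_apply]; congr 1; simp; omega

theorem eq_zero_of_UT_eq_zero {t : TT} (h : UT t = 0) (h0 : t 0 = 0) : t = 0 := by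
  ext n
  cases n with
  | zero => exact h0
  | succ n => rw [← UT_apply, h]; rfl

theorem phi_UXm1 {x : Xm1} (hx : x ∈ cyc dXm1) : phi (UXm1 x) = UW5 (phi x) := by
  obtain ⟨a, b⟩ := x
  change phi (UAS a, UBS b) = (UT (phiT b), 0)
  rw [phi_mk, phiT_UBS]
  congr 1
  funext i
  rw [piAS_UAS, UT_piAS hx]; rfl

theorem single_mem_of_even (s : ℤ) : ∀ b ∈ evenS condB,
    (DFinsupp.single s b : BS) ∈ (AddMonoidHom.range dXm1).comap (AddMonoidHom.inr AS BS) ⊔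
      (evenS condB).map (DFinsupp.singleAddHom (fun _ : ℤ => Bm) 0) := by
  set S := (AddMonoidHom.range dXm1).comap (AddMonoidHom.inr AS BS) ⊔
      (evenS condB).map (DFinsupp.singleAddHom (fun _ : ℤ => Bm) 0) with hS
  have rel (s : ℤ) (a : Am s) (ha : a ∈ evenS (condA s)) :
      (DFinsupp.single s (vMap s a) + DFinsupp.single (s - 1) (hMap s a) : BS) ∈ S :=
    AddSubgroup.mem_sup_left ⟨_, dXm1_single_of_even ha⟩
  induction s using Int.induction_on with
  | zero => exact fun b hb => AddSubgroup.mem_sup_right ⟨b, hb, rfl⟩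
  | succ i ih =>
    intro b hb
    obtain ⟨a, ha, rfl⟩ := evenS_le_map_vMap (i + 1) hb
    have h := rel _ a ha
    rw [add_sub_cancel_right] at h
    exact (S.add_mem_cancel_right (ih _ (evenS_le_comap_hMap _ ha))).1 h
  | pred i ih =>
    intro b hb
    obtain ⟨a, ha, rfl⟩ := evenS_le_map_hMap (-i) hb
    exact (S.add_mem_cancel_left (ih _ (evenS_le_comap_vMap _ ha))).1 (rel _ a ha)

theorem endS_dC_projS {q : CBase → Prop} [DecidablePred q] {s : ℤ}
    (hq : ∀ p, q p ↔ condA s p) (f : Cm) : endS q dC (projS q f) = projS q (dC f) := by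
  suffices h : (asHom (endS q dC)).comp (projS q) = (projS q).comp (asHom dC) from
    DFunLike.congr_fun h f
  refine hom_ext_single fun p => ?_
  change endS q dC (genS q p) = projS q (dC (Finsupp.single p 1))
  by_cases hp : q p
  · exact endS_dC_genS hp
  rw [genS_of_not q hp, map_zero]
  rw [hq] at hp
  obtain ⟨l, m⟩ := p
  by_cases h1 : l = 1
  · subst h1
    have h0 : ¬ q (0, m + 1) := by rw [hq]; simp [condA, jval] at *; omega
    have h2 : ¬ q (2, m) := by rw [hq]; simp [condA, jval] at *; omega
    rw [dC_single_one, map_add]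
    change 0 = genS q _ + genS q _
    rw [genS_of_not q h0, genS_of_not q h2, add_zero]
  by_cases h3 : l = 3
  · subst h3
    have h2 : ¬ q (2, m + 2) := by rw [hq]; simp [condA, jval] at *; omega
    have h4 : ¬ q (4, m) := by rw [hq]; simp [condA, jval] at *; omega
    rw [dC_single_three, map_add]
    change 0 = genS q _ + genS q _
    rw [genS_of_not q h2, genS_of_not q h4, add_zero]
  rw [dC_single_even h1 h3, map_zero]

theorem vMap_projS (s : ℤ) (f : Cm) : vMap s (projS (condA s) f) = projS condB f := by
  suffices h : (vMap s).comp (projS (condA s)) = projS condB from DFunLike.congr_fun h f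
  refine hom_ext_single fun p => ?_
  change vMap s (genS _ p) = genS condB p
  by_cases hp : condA s p
  · exact vMap_genS hp
  · rw [genS_of_not _ hp, map_zero, genS_of_not]
    exact fun h => hp (Or.inl h)

theorem hMap_projS (s : ℤ) (f : Cm) :
    hMap s (projS (condA s) f) = projS condB (flipC (shiftC s f)) := by
  suffices h : (hMap s).comp (projS (condA s)) =
      (projS condB).comp ((asHom flipC).comp (asHom (shiftC s))) from DFunLike.congr_fun h f
  refine hom_ext_single fun p => ?_
  change hMap s (genS _ p) = projS condB (flipC (shiftC s (Finsupp.single p 1)))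
  rw [shiftC_single, flipC_single]
  change _ = genS condB (4 - p.1, p.2 + s - jval p.1)
  by_cases hp : condA s p
  · exact hMap_genS hp
  · rw [genS_of_not _ hp, map_zero, genS_of_not]
    simp only [condA, condB] at *; omega

theorem dC_flipC_shiftC (s : ℤ) (f : Cm) :
    dC (flipC (shiftC s f)) = flipC (shiftC s (dC f)) := by
  suffices h : (asHom dC).comp ((asHom flipC).comp (asHom (shiftC s))) =
      (asHom flipC).comp ((asHom (shiftC s)).comp (asHom dC)) from DFunLike.congr_fun h f
  refine hom_ext_single fun ⟨l, m⟩ => ?_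
  change dC (flipC (shiftC s (Finsupp.single (l, m) 1))) =
    flipC (shiftC s (dC (Finsupp.single (l, m) 1)))
  rw [shiftC_single, flipC_single]
  by_cases h1 : l = 1
  · subst h1
    rw [dC_single_one, map_add, map_add, shiftC_single, shiftC_single, flipC_single, flipC_single]
    refine (dC_single_three _).trans ((add_comm _ _).trans ?_)
    congr 3 <;> simp [jval] <;> ring
  by_cases h3 : l = 3
  · subst h3
    rw [dC_single_three, map_add, map_add, shiftC_single, shiftC_single, flipC_single,
      flipC_single]
    refine (dC_single_one _).trans ((add_comm _ _).trans ?_)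
    congr 3 <;> simp [jval] <;> ring
  have e : dC (Finsupp.single (l, m) 1) = 0 := dC_single_even h1 h3
  rw [e, map_zero, map_zero]
  exact dC_single_even (four_sub_ne h1 h3).1 (four_sub_ne h1 h3).2

theorem dB_vMap (s : ℤ) (a : Am s) : dB (vMap s a) = vMap s (dA s a) :=
  (endS_dC_projS condB_iff _).trans (vMap_projS s _).symm

theorem dB_hMap (s : ℤ) (a : Am s) : dB (hMap s a) = hMap s (dA s a) := by
  have h := hMap_projS s (inclS (condA s) a)
  rw [projS_inclS] at h
  rw [h]
  refine (endS_dC_projS condB_iff _).trans ?_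
  rw [dC_flipC_shiftC]
  exact (hMap_projS s _).symm

theorem dA_mem_evenS (s : ℤ) (a : Am s) : dA s a ∈ evenS (condA s) := by
  rintro ⟨⟨l, m⟩, hp⟩ hl
  exact (projS_apply _ (dC (inclS _ a)) _).trans (dC_apply_odd _ hl)

theorem dA_sgnA (s : ℤ) (a : Am s) : dA s (sgnA s a) = -dA s a := by
  suffices h : (asHom (dA s)).comp (asHom (sgnA s)) = -asHom (dA s) from DFunLike.congr_fun h a
  refine hom_ext_genS _ fun p hp => ?_
  change dA s (sgnA s (genS _ p)) = -dA s (genS _ p)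
  rw [sgnA_genS ⟨p, hp⟩]
  by_cases h : p.1 = 1 ∨ p.1 = 3
  · have hg : ∀ l : Fin 5, l = 1 ∨ l = 3 → ¬ Even (grval l) := by decide
    have : ¬ Even (grval p.1 - 2 * p.2) := fun e =>
      hg p.1 h (by simpa using e.add (even_two_mul p.2))
    rw [if_neg this, map_zsmul, neg_smul, one_smul]
  · push Not at h
    have : dA s (genS _ p) = 0 := evenS_le_ker (genS_mem_evenS _ h.1 h.2)
    rw [map_zsmul, this, smul_zero, neg_zero]

theorem dBS_Dm1_sgnAS (a : AS) : dBS (Dm1 (sgnAS a)) = -Dm1 (sgnAS (dAS a)) := by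
  suffices h : (asHom dBS).comp (Dm1.comp (asHom sgnAS)) =
      -(Dm1.comp ((asHom sgnAS).comp (asHom dAS))) from DFunLike.congr_fun h a
  refine DFinsupp.addHom_ext fun s x => ?_
  change dBS (Dm1 (sgnAS (DFinsupp.single s x))) = -Dm1 (sgnAS (dAS (DFinsupp.single s x)))
  rw [dAS_single, sgnAS_single, sgnAS_single, sgnA_of_mem_evenS (dA_mem_evenS s x), Dm1_single,
    Dm1_single, map_add, dBS_single, dBS_single, dB_vMap, dB_hMap, dA_sgnA, map_neg, map_neg,
    DFinsupp.single_neg, DFinsupp.single_neg, neg_add]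

theorem mem_range_of_phi_eq_zero (x : Xm1) (hx : x ∈ cyc dXm1) (h0 : phi x = 0) :
    x ∈ AddMonoidHom.range dXm1 := by
  obtain ⟨a, b⟩ := x
  have ht (s : ℤ) : piAS s a = 0 := by
    by_cases h3 : 3 ≤ s
    · exact piAS_eq_zero_of_three_le hx h3
    by_cases h4 : s ≤ -3
    · exact piAS_eq_zero_of_le_neg_three hx h4
    refine eq_zero_of_UT_eq_zero (UT_piAS hx s) ?_
    have h := congrFun (congrArg Prod.snd h0) ⟨(s + 2).toNat, by omega⟩
    have e : (((s + 2).toNat : ℕ) : ℤ) - 2 = s := by omega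
    rw [phi_mk] at h
    simp only [e] at h
    exact h
  obtain ⟨a', rfl⟩ : ∃ a', dAS a' = a := by
    have h : a ∈ AddMonoidHom.range dAS := by
      refine mem_of_single_mem a fun s => ?_
      obtain ⟨y, hy⟩ :=
        mem_range_of_piS_eq_zero (fun _ => Iff.rfl) (mem_evenS_of_cycle hx s) (ht s)
      exact ⟨DFinsupp.single s y, (dAS_single s y).trans (congrArg _ hy)⟩
    exact h
  set b' := b - Dm1 (sgnAS a') with hb'
  have hx' : ((dAS a', b) : Xm1) = dXm1 (a', 0) + (0, b') := by
    rw [dXm1_mk, map_zero, zero_add, Prod.mk_add_mk, add_zero, hb', add_sub_cancel]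
  have hb0 : phi (0, b') = 0 := by
    rw [hx', map_add, phi_dXm1, zero_add] at h0; exact h0
  have hdb : dBS b' = 0 := by
    have h : dBS b + Dm1 (sgnAS (dAS a')) = 0 :=
      congrArg Prod.snd (show dXm1 (dAS a', b) = 0 from hx)
    rw [hb', map_sub, dBS_Dm1_sgnAS, sub_neg_eq_add, h]
  have hmem : b' ∈ (AddMonoidHom.range dXm1).comap (AddMonoidHom.inr AS BS) ⊔
      (evenS condB).map (DFinsupp.singleAddHom (fun _ : ℤ => Bm) 0) := by
    refine mem_of_single_mem b' fun s => single_mem_of_even s _ (cyc_le_evenS condB_iff ?_)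
    change dB (b' s) = 0
    rw [← dBS_apply, hdb]; rfl
  obtain ⟨y, ⟨z, hz⟩, w, ⟨c, hc, hw⟩, hyw⟩ := AddSubgroup.mem_sup.1 hmem
  have hz' : dXm1 z = (0, y) := hz
  have e : ((0, b') : Xm1) = dXm1 z + (0, DFinsupp.single 0 c) := by
    rw [← hyw, hz', ← hw, Prod.mk_add_mk, add_zero]; rfl
  have hpc : piS condB 3 c = 0 := by
    rw [e, map_add, phi_dXm1, zero_add, phi_mk] at hb0
    have h := congrArg Prod.fst hb0
    simpa [phiT_single, tri] using h
  obtain ⟨c', hc'⟩ := mem_range_of_piS_eq_zero condB_iff hc hpc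
  have hc'' : dB c' = c := hc'
  have e' : dXm1 (0, DFinsupp.single 0 c') = (0, DFinsupp.single 0 c) := by
    rw [dXm1_mk, dBS_single, hc'', map_zero, map_zero, map_zero, add_zero]
  rw [hx', e, ← e', ← map_add, ← map_add]
  exact ⟨_, rfl⟩

theorem piS_sigmaS {q : CBase → Prop} [DecidablePred q] {s : ℤ} (hq : ∀ p, q p ↔ condA s p)
    (t : TT) : piS q s (sigmaS q s t) = t := by
  suffices h : (piS q s).comp (sigmaS q s) = AddMonoidHom.id _ from DFunLike.congr_fun h t
  ext1 j
  ext1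
  have : sigmaS q s (Finsupp.single j 1) = genS q (2, cutoff s - j) := by simp [sigmaS]
  change piS q s (sigmaS q s (Finsupp.single j 1)) = Finsupp.single j 1
  rw [this, piS_genS_two hq]
  simp [tau]

theorem sigmaS_mem_evenS {q : CBase → Prop} [DecidablePred q] {s : ℤ} (t : TT) :
    sigmaS q s t ∈ evenS q := by
  induction t using Finsupp.induction_linear with
  | zero => rw [map_zero]; exact zero_mem _
  | add x y hx hy => rw [map_add]; exact add_mem hx hy
  | single j n =>
    have : sigmaS q s (Finsupp.single j n) = n • genS q (2, cutoff s - j) := by simp [sigmaS]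
    rw [this]
    exact zsmul_mem (genS_mem_evenS q (by simp) (by simp)) _

theorem mk_zero_mem_map_phi (t : TT) : ((t, 0) : W5) ∈ (cyc dXm1).map phi := by
  refine ⟨(0, DFinsupp.single 0 (sigmaS condB 3 t)), ?_, ?_⟩
  · have h : dB (sigmaS condB 3 t) = 0 := evenS_le_ker (sigmaS_mem_evenS t)
    change dXm1 _ = 0
    rw [dXm1_mk, dBS_single, h, DFinsupp.single_zero, map_zero, map_zero, map_zero, add_zero]
    rfl
  · rw [phi_mk, phiT_single, piS_sigmaS condB_iff]
    ext1
    · simp [tri]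
    · funext i; simp

theorem exists_cycle_over (i : Fin 5) :
    ∃ t : TT, ((t, Pi.single i 1) : W5) ∈ (cyc dXm1).map phi := by
  set s : ℤ := (i : ℕ) - 2 with hs
  set y : Am s := sigmaS (condA s) s (tau 0) with hy
  have hye : y ∈ evenS (condA s) := sigmaS_mem_evenS _
  have hpy : piS (condA s) s y = tau 0 := piS_sigmaS (fun _ => Iff.rfl) _
  have hc : 0 ≤ cutoff s ∧ 0 ≤ cutoff s + s := by unfold cutoff; omega
  obtain ⟨b₁, hb₁⟩ : vMap s y ∈ AddMonoidHom.range dB := by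
    refine mem_range_of_piS_eq_zero condB_iff (evenS_le_comap_vMap s hye) ?_
    rw [piS_vMap, hpy, UT_pow_tau, tau_of_neg (by omega)]
  obtain ⟨b₂, hb₂⟩ : hMap s y ∈ AddMonoidHom.range dB := by
    refine mem_range_of_piS_eq_zero condB_iff (evenS_le_comap_hMap s hye) ?_
    rw [piS_hMap, hpy, UT_pow_tau, tau_of_neg (by omega)]
  have hb₁' : dB b₁ = vMap s y := hb₁
  have hb₂' : dB b₂ = hMap s y := hb₂
  refine ⟨_, ⟨(DFinsupp.single s y, 0) - (0, DFinsupp.single s b₁ + DFinsupp.single (s - 1) b₂),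
    ?_, Prod.ext rfl ?_⟩⟩
  · change dXm1 _ = 0
    rw [map_sub, dXm1_single_of_even hye, dXm1_mk, map_add, dBS_single, dBS_single, hb₁', hb₂']
    simp
  · funext j
    rw [Prod.mk_sub_mk, phi_mk, sub_zero]
    change piAS _ _ 0 = _
    rw [piAS_apply]
    by_cases h : j = i
    · subst h
      rw [← hs, DFinsupp.single_eq_same, hpy]
      simp [tau]
    · have : ((j : ℕ) : ℤ) - 2 ≠ s := fun e => h (Fin.ext (by omega))
      have e : piS (condA (((j : ℕ) : ℤ) - 2)) (((j : ℕ) : ℤ) - 2)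
          ((DFinsupp.single s y : AS) (((j : ℕ) : ℤ) - 2)) = 0 := by
        rw [DFinsupp.single_eq_of_ne this]
        exact map_zero _
      have e' : (Pi.single i 1 : Fin 5 → ℤ) j = 0 := Pi.single_eq_of_ne h _
      exact (DFunLike.congr_fun e 0).trans e'.symm

theorem phi_surjective_on_cycles (w : W5) : ∃ x ∈ cyc dXm1, phi x = w := by
  change w ∈ (cyc dXm1).map phi
  obtain ⟨t, k⟩ := w
  have he (i : Fin 5) : ((0, Pi.single i 1) : W5) ∈ (cyc dXm1).map phi := by
    obtain ⟨t, ht⟩ := exists_cycle_over i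
    simpa using sub_mem ht (mk_zero_mem_map_phi t)
  have hk : ((t, k) : W5) = (t, 0) + ∑ i, k i • ((0, Pi.single i 1) : W5) := by
    ext1
    · simp [Prod.fst_sum]
    · funext j
      simp [Prod.snd_sum, Finset.sum_apply, Pi.single_apply]
  rw [hk]
  exact add_mem (mk_zero_mem_map_phi t) (sum_mem fun i _ => zsmul_mem (he i) _)

/-- For the torus knot `T_{3,4}`: the homology of the mapping cone `X⁺(−1)` of
`D⁺₋₁ : ⊕_s A⁺_s → ⊕_s B⁺_s` is isomorphic, as a `ℤ[U]`-module, to `T ⊕ (ℤ[U]/U)⁵`.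
This computes `HF⁺` of `−1`-surgery on `T_{3,4}`, i.e. of `Σ(3,4,13)`. -/
theorem stmt15 :
    ∃ e : Hq dXm1 ≃+ W5,
      ∀ (x : Xm1) (hx : x ∈ cyc dXm1) (hUx : UXm1 x ∈ cyc dXm1),
        e (hcl dXm1 (UXm1 x) hUx) = UW5 (e (hcl dXm1 x hx)) := by
  obtain ⟨e, he⟩ := exists_homology_equiv dXm1 phi phi_dXm1 mem_range_of_phi_eq_zero
    phi_surjective_on_cycles
  exact ⟨e, fun x hx hUx => by rw [he, he, phi_UXm1 hx]⟩
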